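/- Fix 0 < r < 1 and 0 < δ < 1, and let C₁ = (1+δ)²r(1−r) / (2δ²√r(1+√r)²). Then for all ξ, ζ ∈ S_δ, |p̄(ξ) − p̄(ζ)| ≤ C₁ · | ξ₁/|ξ|₁ − ζ₁/|ζ|₁ |. -/

import Mathlib

noncomputable section

/-- The minimizing parameter `p̄(ξ₁,ξ₂)`. -/
def pbar (r a b : ℝ) : ℝ :=
  (r * (a + b) + (r + 1) * Real.sqrt (r * a * b)) /
    (a + r * b + 2 * Real.sqrt (r * a * b))

/-- The cone `S_δ = {x ∈ ℝ²_{>0} : x₁ ≥ δx₂, x₂ ≥ δx₁}`. -/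
def Scone (δ : ℝ) : Set (ℝ × ℝ) :=
  {x | 0 < x.1 ∧ 0 < x.2 ∧ δ * x.2 ≤ x.1 ∧ δ * x.1 ≤ x.2}

lemma pbar_red (r δ : ℝ) (hr0 : 0 < r) (ξ : ℝ × ℝ) (hξ : ξ ∈ Scone δ) :
    ∃ t : ℝ, 0 < t ∧ δ ≤ t ^ 2 ∧ δ * t ^ 2 ≤ 1 ∧
      pbar r ξ.1 ξ.2 = √r * (√r * t + 1) / (t + √r) ∧
      ξ.1 / (ξ.1 + ξ.2) = t ^ 2 / (1 + t ^ 2) := by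
  obtain ⟨a, b⟩ := ξ
  obtain ⟨ha, hb, h1, h2⟩ := hξ
  simp only at ha hb h1 h2 ⊢
  obtain ⟨x, hx, rfl⟩ : ∃ x : ℝ, 0 < x ∧ x ^ 2 = a :=
    ⟨√a, Real.sqrt_pos.2 ha, Real.sq_sqrt ha.le⟩
  obtain ⟨y, hy, rfl⟩ : ∃ y : ℝ, 0 < y ∧ y ^ 2 = b :=
    ⟨√b, Real.sqrt_pos.2 hb, Real.sq_sqrt hb.le⟩
  obtain ⟨s, hs, rfl⟩ : ∃ s : ℝ, 0 < s ∧ s ^ 2 = r :=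
    ⟨√r, Real.sqrt_pos.2 hr0, Real.sq_sqrt hr0.le⟩
  have e1 : √(s ^ 2) = s := Real.sqrt_sq hs.le
  have e2 : √(s ^ 2 * x ^ 2 * y ^ 2) = s * x * y := by
    rw [show s ^ 2 * x ^ 2 * y ^ 2 = (s * x * y) ^ 2 by ring]
    exact Real.sqrt_sq (by positivity)
  refine ⟨x / y, by positivity, ?_, ?_, ?_, ?_⟩
  · rw [div_pow, le_div_iff₀ hb]; exact h1
  · rw [div_pow, ← mul_div_assoc, div_le_one hb]; exact h2
  · have hd : x ^ 2 + s ^ 2 * y ^ 2 + 2 * (s * x * y) = (x + s * y) ^ 2 := by ring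
    have h3 : x / y + s = (x + s * y) / y := by field_simp
    have h4 : s * (x / y) + 1 = (s * x + y) / y := by field_simp
    have h5 : x + s * y ≠ 0 := by positivity
    rw [e1, pbar, e2, hd, h3, h4]
    field_simp
    ring
  · field_simp
    ring

lemma pbar_g (δ s t : ℝ) (hδ0 : 0 < δ) (hs : 0 < s) (ht : 0 < t)
    (h1 : δ ≤ t ^ 2) (h2 : δ * t ^ 2 ≤ 1) :
    ∃ m : ℝ, 0 < m ∧ m ≤ 1 ∧ m ≤ t ∧ δ * (1 + t ^ 2) ≤ (1 + δ) * m ^ 2 ∧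
      m * (1 + s) ≤ t + s := by
  rcases le_total t 1 with h | h
  · exact ⟨t, ht, h, le_rfl, by nlinarith, by nlinarith⟩
  · exact ⟨1, one_pos, le_rfl, h, by nlinarith, by nlinarith⟩

lemma pbar_key (δ s t w : ℝ) (hδ0 : 0 < δ) (hs : 0 < s) (ht : 0 < t) (hw : 0 < w)
    (h1 : δ ≤ t ^ 2) (h2 : δ * t ^ 2 ≤ 1) (h3 : δ ≤ w ^ 2) (h4 : δ * w ^ 2 ≤ 1) :
    2 * δ ^ 2 * (1 + s) ^ 2 * ((1 + t ^ 2) * (1 + w ^ 2)) ≤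
      (1 + δ) ^ 2 * (t + w) * ((t + s) * (w + s)) := by
  obtain ⟨m, hm, hm1, hmt, hg, hms⟩ := pbar_g δ s t hδ0 hs ht h1 h2
  obtain ⟨n, hn, hn1, hnw, hg', hns⟩ := pbar_g δ s w hδ0 hs hw h3 h4
  have hmn : 2 * (m * n) ≤ t + w := by nlinarith
  calc 2 * δ ^ 2 * (1 + s) ^ 2 * ((1 + t ^ 2) * (1 + w ^ 2))
      = 2 * (1 + s) ^ 2 * ((δ * (1 + t ^ 2)) * (δ * (1 + w ^ 2))) := by ring
    _ ≤ 2 * (1 + s) ^ 2 * (((1 + δ) * m ^ 2) * ((1 + δ) * n ^ 2)) := by gcongr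
    _ = (1 + δ) ^ 2 * (2 * (m * n)) * ((m * (1 + s)) * (n * (1 + s))) := by ring
    _ ≤ _ := by gcongr

/-- **Lipschitz bound for `ξ ↦ p̄(ξ)` on the cone `S_δ`.**
For `0 < r < 1` and `0 < δ < 1`, with `C₁ = (1+δ)²r(1−r)/(2δ²√r(1+√r)²)`,
`|p̄(ξ) − p̄(ζ)| ≤ C₁ |ξ₁/|ξ|₁ − ζ₁/|ζ|₁|` for all `ξ, ζ ∈ S_δ`. -/
theorem pbar_lipschitz (r δ : ℝ) (hr0 : 0 < r) (hr1 : r < 1)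
    (hδ0 : 0 < δ) (hδ1 : δ < 1)
    (ξ ζ : ℝ × ℝ) (hξ : ξ ∈ Scone δ) (hζ : ζ ∈ Scone δ) :
    |pbar r ξ.1 ξ.2 - pbar r ζ.1 ζ.2| ≤
      (1 + δ) ^ 2 * r * (1 - r) / (2 * δ ^ 2 * Real.sqrt r * (1 + Real.sqrt r) ^ 2) *
        |ξ.1 / (ξ.1 + ξ.2) - ζ.1 / (ζ.1 + ζ.2)| := by
  obtain ⟨t, ht, h1, h2, e1, e2⟩ := pbar_red r δ hr0 ξ hξ
  obtain ⟨w, hw, h3, h4, e3, e4⟩ := pbar_red r δ hr0 ζ hζ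
  rw [e1, e2, e3, e4]
  obtain ⟨s, hs, rfl⟩ : ∃ s : ℝ, 0 < s ∧ s ^ 2 = r :=
    ⟨√r, Real.sqrt_pos.2 hr0, Real.sq_sqrt hr0.le⟩
  rw [Real.sqrt_sq hs.le]
  have key := pbar_key δ s t w hδ0 hs ht hw h1 h2 h3 h4
  have hp : 0 < 1 - s ^ 2 := by linarith
  have l1 : s * (s * t + 1) / (t + s) - s * (s * w + 1) / (w + s) =
      (s * (1 - s ^ 2) / ((t + s) * (w + s))) * (w - t) := by
    field_simp
    ring
  have l2 : t ^ 2 / (1 + t ^ 2) - w ^ 2 / (1 + w ^ 2) =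
      -((t + w) / ((1 + t ^ 2) * (1 + w ^ 2)) * (w - t)) := by
    field_simp
    ring
  rw [l1, l2, abs_neg, abs_mul, abs_mul, abs_of_pos (by positivity),
    abs_of_pos (a := (t + w) / ((1 + t ^ 2) * (1 + w ^ 2))) (by positivity), ← mul_assoc]
  refine mul_le_mul_of_nonneg_right ?_ (abs_nonneg _)
  have l3 : (1 + δ) ^ 2 * s ^ 2 * (1 - s ^ 2) / (2 * δ ^ 2 * s * (1 + s) ^ 2) *
      ((t + w) / ((1 + t ^ 2) * (1 + w ^ 2))) =
      (s * (1 - s ^ 2)) * ((1 + δ) ^ 2 * (t + w)) /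
        (2 * δ ^ 2 * (1 + s) ^ 2 * ((1 + t ^ 2) * (1 + w ^ 2))) := by
    field_simp
  rw [l3, div_le_div_iff₀ (by positivity) (by positivity), mul_assoc (s * (1 - s ^ 2))]
  exact mul_le_mul_of_nonneg_left key (by positivity)

end
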